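/- Assume the solution is nontrivial (S is not a horizontal line) and u² + v² ≠ 0 at every point of the closure of Ω. If ω ≤ 0 throughout the fluid domain Ω and u < 0 at some crest or at some trough, then the relative speed √(u² + v²) over the closure of Ω is minimized at every crest: for every crest z* and every point z in the closure of Ω, (u² + v²)(z) ≥ (u² + v²)(z*). -/

import Mathlib

open Set

/-- Partial derivative in the horizontal direction. -/
noncomputable def pdX (f : ℝ × ℝ → ℝ) (p : ℝ × ℝ) : ℝ := fderiv ℝ f p (1, 0)

/-- Partial derivative in the vertical direction. -/
noncomputable def pdY (f : ℝ × ℝ → ℝ) (p : ℝ × ℝ) : ℝ := fderiv ℝ f p (0, 1)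

/-- A general (possibly overturning, possibly asymmetric) horizontally `2L`-periodic
steady water wave.  The free surface `S` is the non-self-intersecting `C²` curve
parametrized by `s ↦ (X s, Y s)`, lying above the bed `B = {y = -d}`, and the fluid
domain `Ω` is the open connected `2L`-periodic region whose boundary is `S ∪ B`.
The flow `(u, v)` with pressure `P` solves the steady Euler equations in `Ω`, is
tangent to `S`, has `P = Patm` on `S` and `v = 0` on `B`; `ψ` is a stream function,
vanishing on `S` and equal to the constant `m` on `B`. -/
structure GenPeriodicFlow (g Patm L d : ℝ) : Type where
  X : ℝ → ℝ
  Y : ℝ → ℝ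
  T : ℝ
  u : ℝ × ℝ → ℝ
  v : ℝ × ℝ → ℝ
  P : ℝ × ℝ → ℝ
  ψ : ℝ × ℝ → ℝ
  m : ℝ
  Ω : Set (ℝ × ℝ)
  T_pos : 0 < T
  X_smooth : ContDiff ℝ 2 X
  Y_smooth : ContDiff ℝ 2 Y
  regular : ∀ s, deriv X s ^ 2 + deriv Y s ^ 2 ≠ 0
  X_per : ∀ s, X (s + T) = X s + 2 * L
  Y_per : ∀ s, Y (s + T) = Y s
  S_above_bed : ∀ s, -d < Y s
  S_simple : ∀ s s', X s = X s' → Y s = Y s' → ∃ n : ℤ, s' = s + n * T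
  Ω_open : IsOpen Ω
  Ω_conn : IsConnected Ω
  Ω_per : ∀ p : ℝ × ℝ, p ∈ Ω ↔ (p.1 + 2 * L, p.2) ∈ Ω
  Ω_frontier : frontier Ω = (range fun s => (X s, Y s)) ∪ {p : ℝ × ℝ | p.2 = -d}
  u_smooth : ContDiff ℝ 1 u
  v_smooth : ContDiff ℝ 1 v
  P_smooth : ContDiff ℝ 2 P
  ψ_smooth : ContDiff ℝ 2 ψ
  u_periodic : ∀ x y, u (x + 2 * L, y) = u (x, y)
  v_periodic : ∀ x y, v (x + 2 * L, y) = v (x, y)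
  P_periodic : ∀ x y, P (x + 2 * L, y) = P (x, y)
  euler_x : ∀ p ∈ Ω, u p * pdX u p + v p * pdY u p = -pdX P p
  euler_y : ∀ p ∈ Ω, u p * pdX v p + v p * pdY v p = -(pdY P p) - g
  incompressible : ∀ p ∈ Ω, pdX u p + pdY v p = 0
  surface_pressure : ∀ s, P (X s, Y s) = Patm
  surface_tangency : ∀ s, u (X s, Y s) * deriv Y s = v (X s, Y s) * deriv X s
  bed_kinematic : ∀ x, v (x, -d) = 0
  psi_x : ∀ p ∈ closure Ω, pdX ψ p = -v p
  psi_y : ∀ p ∈ closure Ω, pdY ψ p = u p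
  psi_surface : ∀ s, ψ (X s, Y s) = 0
  psi_bed : ∀ x, ψ (x, -d) = m

namespace GenPeriodicFlow

variable {g Patm L d : ℝ}

/-- The vorticity `ω = v_x - u_y`. -/
noncomputable def vort (F : GenPeriodicFlow g Patm L d) (p : ℝ × ℝ) : ℝ :=
  pdX F.v p - pdY F.u p

/-- The free surface `S`, as a subset of the plane. -/
def surf (F : GenPeriodicFlow g Patm L d) : Set (ℝ × ℝ) :=
  range fun s => (F.X s, F.Y s)

/-- The maximal surface height `maxη = max_S y`. -/
noncomputable def maxη (F : GenPeriodicFlow g Patm L d) : ℝ := sSup (range F.Y)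

/-- The minimal surface height `minη = min_S y`. -/
noncomputable def minη (F : GenPeriodicFlow g Patm L d) : ℝ := sInf (range F.Y)

/-- The solution is nontrivial: `S` is not a horizontal line. -/
def Nontrivial' (F : GenPeriodicFlow g Patm L d) : Prop := ∃ s s', F.Y s ≠ F.Y s'

/-- `n` is an outward (non-fluid side) normal to `S` at the parameter `s`:
it is orthogonal to the tangent vector and points out of the fluid. -/
def IsOutwardNormalAt (F : GenPeriodicFlow g Patm L d) (n : ℝ × ℝ) (s : ℝ) : Prop :=
  n.1 * deriv F.X s + n.2 * deriv F.Y s = 0 ∧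
  ∃ t₀ > 0, ∀ t, 0 < t → t < t₀ → (F.X s + t * n.1, F.Y s + t * n.2) ∉ closure F.Ω

end GenPeriodicFlow


open Filter Topology in
/-- For a closed curve `c`, the integral `∮ dc / (c - w)` is locally constant in `w` off the curve. -/
theorem hasDerivAt_integral_closed_curve {c c' : ℝ → ℂ} {T : ℝ} (hT : 0 ≤ T)
    (hc : ∀ t, HasDerivAt c (c' t) t) (hc' : Continuous c') (hclosed : c T = c 0)
    {w₀ : ℂ} (hw : w₀ ∉ c '' Icc 0 T) :
    HasDerivAt (fun w => ∫ t in (0 : ℝ)..T, c' t / (c t - w)) 0 w₀ := by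
  have hcc : Continuous c := continuous_iff_continuousAt.2 fun t => (hc t).continuousAt
  have hK : IsCompact (c '' Icc 0 T) := isCompact_Icc.image hcc
  obtain ⟨δ, hδ, hball⟩ : ∃ δ > 0, Metric.ball w₀ δ ⊆ (c '' Icc 0 T)ᶜ :=
    Metric.isOpen_iff.1 hK.isClosed.isOpen_compl w₀ hw
  have hfar : ∀ w ∈ Metric.ball w₀ (δ / 2), ∀ t ∈ Icc 0 T, δ / 2 ≤ ‖c t - w‖ := by
    intro w hw t ht
    by_contra! h
    refine hball (show c t ∈ Metric.ball w₀ δ from ?_) (mem_image_of_mem c ht)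
    rw [Metric.mem_ball] at hw ⊢
    calc dist (c t) w₀ ≤ dist (c t) w + dist w w₀ := dist_triangle _ _ _
      _ < δ := by rw [dist_eq_norm (c t) w]; linarith
  have hne : ∀ w ∈ Metric.ball w₀ (δ / 2), ∀ t ∈ Icc 0 T, c t - w ≠ 0 := fun w hw t ht h0 => by
    have := hfar w hw t ht
    rw [h0, norm_zero] at this
    linarith
  have hw₀ : w₀ ∈ Metric.ball w₀ (δ / 2) := Metric.mem_ball_self (by positivity)
  have hsub : uIoc 0 T ⊆ Icc 0 T := by rw [uIoc_of_le hT]; exact Ioc_subset_Icc_self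
  have hcont : ∀ w ∈ Metric.ball w₀ (δ / 2), ContinuousOn (fun t => c' t / (c t - w)) (Icc 0 T) :=
    fun w hw => hc'.continuousOn.div (hcc.sub continuous_const).continuousOn (hne w hw)
  have hcont2 : ContinuousOn (fun t => c' t / (c t - w₀) ^ 2) (Icc 0 T) :=
    hc'.continuousOn.div ((hcc.sub continuous_const).pow 2).continuousOn
      fun t ht => pow_ne_zero 2 (hne w₀ hw₀ t ht)
  have key := (intervalIntegral.hasDerivAt_integral_of_dominated_loc_of_deriv_le
    (μ := MeasureTheory.volume) (a := 0) (b := T)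
    (F := fun w t => c' t / (c t - w)) (F' := fun w t => c' t / (c t - w) ^ 2)
    (x₀ := w₀) (s := Metric.ball w₀ (δ / 2)) (bound := fun t => ‖c' t‖ / (δ / 2) ^ 2)
    (Metric.ball_mem_nhds _ (by positivity)) ?_ ?_ ?_ ?_ ?_ ?_).2
  · have hzero : ∫ t in (0 : ℝ)..T, c' t / (c t - w₀) ^ 2 = 0 := by
      rw [intervalIntegral.integral_eq_sub_of_hasDerivAt (f := fun t => -(c t - w₀)⁻¹)]
      · simp [hclosed]
      · intro t ht
        rw [uIcc_of_le hT] at ht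
        exact (((hc t).sub_const w₀).fun_inv (hne w₀ hw₀ t ht)).fun_neg.congr_deriv (by ring)
      · apply ContinuousOn.intervalIntegrable
        rwa [uIcc_of_le hT]
    rwa [hzero] at key
  · filter_upwards [Metric.ball_mem_nhds w₀ (half_pos hδ)] with w hw
    exact ((hcont w hw).mono hsub).aestronglyMeasurable measurableSet_uIoc
  · apply ContinuousOn.intervalIntegrable
    rw [uIcc_of_le hT]
    exact hcont w₀ hw₀
  · exact (hcont2.mono hsub).aestronglyMeasurable measurableSet_uIoc
  · refine Eventually.of_forall fun t ht w hw => ?_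
    rw [norm_div, norm_pow]
    have := hfar w hw t (hsub ht)
    gcongr
  · exact (Continuous.div_const hc'.norm _).intervalIntegrable _ _
  · refine Eventually.of_forall fun t ht w hw => ?_
    have h0 := hne w hw t (hsub ht)
    have h1 : HasDerivAt (fun w => c t - w) (-1) w := (hasDerivAt_id w).const_sub (c t)
    exact ((h1.fun_inv h0).const_mul (c' t)).congr_deriv (by ring)

open Filter Topology in
/-- The integral `∮ dc / (c - w)` vanishes as `w → ∞`. -/
theorem tendsto_integral_closed_curve {c c' : ℝ → ℂ} {T : ℝ} (hT : 0 ≤ T)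
    (hc : Continuous c) (hc' : Continuous c') {w : ℝ → ℂ} (hw : Tendsto (fun y => ‖w y‖) atTop atTop) :
    Tendsto (fun y => ∫ t in (0 : ℝ)..T, c' t / (c t - w y)) atTop (𝓝 0) := by
  obtain ⟨M, hM⟩ := isCompact_Icc.exists_bound_of_continuousOn (s := Icc 0 T) hc.continuousOn
  obtain ⟨M', hM'⟩ := isCompact_Icc.exists_bound_of_continuousOn (s := Icc 0 T) hc'.continuousOn
  have hlim : Tendsto (fun y => M' / (‖w y‖ - M) * |T - 0|) atTop (𝓝 0) := by
    have h1 : Tendsto (fun y => ‖w y‖ - M) atTop atTop := tendsto_atTop_add_const_right _ _ hw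
    simpa using (h1.const_div_atTop M').mul_const |T - 0|
  refine squeeze_zero_norm' ?_ hlim
  filter_upwards [hw.eventually_gt_atTop M] with y hy
  refine intervalIntegral.norm_integral_le_of_norm_le_const fun t ht => ?_
  rw [uIoc_of_le hT] at ht
  have ht' := Ioc_subset_Icc_self ht
  have h1 := hM t ht'
  have h2 := hM' t ht'
  have h3 : ‖w y‖ - M ≤ ‖c t - w y‖ := by
    have := norm_sub_norm_le (w y) (c t)
    rw [norm_sub_rev] at this
    linarith
  have hpos : 0 < ‖w y‖ - M := by linarith
  rw [norm_div]
  have := (norm_nonneg _).trans h2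
  gcongr

open Filter Topology in
/-- A horizontally periodic curve separates lower half planes from upper half planes. -/
theorem false_of_isPreconnected_of_periodic_curve {X Y : ℝ → ℝ} {T L a b : ℝ} {D : Set (ℝ × ℝ)}
    (hT : 0 < T) (hL : 0 < L) (hX : ContDiff ℝ 1 X) (hY : ContDiff ℝ 1 Y)
    (hXper : ∀ s, X (s + T) = X s + 2 * L) (hYper : ∀ s, Y (s + T) = Y s)
    (hDo : IsOpen D) (hD : IsPreconnected D) (havoid : ∀ s, (X s, Y s) ∉ D)
    (hlow : ∀ p : ℝ × ℝ, p.2 < a → p ∈ D) (hup : ∀ p : ℝ × ℝ, b < p.2 → p ∈ D) : False := by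
  set k : ℂ := Real.pi * Complex.I / L with hk
  have hLc : (L : ℂ) ≠ 0 := by exact_mod_cast hL.ne'
  have hpi : (Real.pi : ℂ) ≠ 0 := by exact_mod_cast Real.pi_ne_zero
  have hk0 : k ≠ 0 := by simp [hk, hLc, hpi]
  set E : ℝ × ℝ → ℂ := fun p => Complex.exp (k * (p.1 + p.2 * Complex.I)) with hE
  set c : ℝ → ℂ := fun s => E (X s, Y s) with hcdef
  set ζ' : ℝ → ℂ := fun s => k * ((deriv X s : ℝ) + (deriv Y s : ℝ) * Complex.I) with hζ'
  have hζ : ∀ s, HasDerivAt (fun s => k * ((X s : ℂ) + (Y s : ℂ) * Complex.I)) (ζ' s) s := fun s =>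
    (((hX.differentiable one_ne_zero s).hasDerivAt.ofReal_comp).add
      (((hY.differentiable one_ne_zero s).hasDerivAt.ofReal_comp).mul_const Complex.I)).const_mul k
  set c' : ℝ → ℂ := fun s => c s * ζ' s with hc'def
  have hc : ∀ s, HasDerivAt c (c' s) s := fun s => (hζ s).cexp
  have hcc : Continuous c := continuous_iff_continuousAt.2 fun t => (hc t).continuousAt
  have hζ'c : Continuous ζ' := by
    have h1 := hX.continuous_deriv le_rfl
    have h2 := hY.continuous_deriv le_rfl
    fun_prop
  have hc'c : Continuous c' := hcc.mul hζ'c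
  have hkL : k * (2 * L) = 2 * Real.pi * Complex.I := by
    rw [hk]; field_simp
  have hclosed : c T = c 0 := by
    have h1 := hXper 0
    have h2 := hYper 0
    rw [zero_add] at h1 h2
    simp only [hcdef, hE, h1, h2]
    rw [Complex.exp_eq_exp_iff_exists_int]
    refine ⟨1, ?_⟩
    push_cast
    linear_combination hkL
  have hXn : ∀ (n : ℤ) s, X (s + n * T) = X s + n * (2 * L) := by
    intro n s
    have hper : Function.Periodic (fun s => X s - s / T * (2 * L)) T := fun s => by
      simp only [hXper]
      field_simp
      ring
    have := hper.int_mul n s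
    field_simp at this
    have h3 : T * (X (s + n * T)) = T * (X s + n * (2 * L)) := by linarith
    exact mul_left_cancel₀ hT.ne' h3
  have hYn : ∀ (n : ℤ) s, Y (s + n * T) = Y s := fun n s => Function.Periodic.int_mul hYper n s
  have hEne : ∀ p ∈ D, E p ∉ c '' Icc 0 T := by
    rintro p hp ⟨s, -, hs⟩
    simp only [hcdef, hE] at hs
    rw [Complex.exp_eq_exp_iff_exists_int] at hs
    obtain ⟨n, hn⟩ := hs
    have h1 : (p.1 : ℂ) + p.2 * Complex.I
        = ((X s - n * (2 * L) : ℝ) : ℂ) + (Y s : ℝ) * Complex.I := by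
      apply mul_left_cancel₀ hk0
      push_cast
      linear_combination -hn + n * hkL
    have h2 := congrArg Complex.re h1
    have h3 := congrArg Complex.im h1
    simp only [Complex.add_re, Complex.add_im, Complex.ofReal_re, Complex.ofReal_im,
      Complex.re_ofReal_mul, Complex.im_ofReal_mul, Complex.I_re, Complex.I_im, mul_zero, mul_one,
      add_zero, zero_add] at h2 h3
    refine havoid (s + (-n : ℤ) * T) ?_
    rw [hXn, hYn]
    convert hp
    · push_cast; linarith
    · exact h3.symm
  set N : ℂ → ℂ := fun w => ∫ t in (0 : ℝ)..T, c' t / (c t - w) with hN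
  have hNd : ∀ w ∉ c '' Icc 0 T, HasDerivAt N 0 w := fun w hw =>
    hasDerivAt_integral_closed_curve hT.le hc hc'c hclosed hw
  have hEd : Differentiable ℝ E := by
    have h1 : Differentiable ℝ fun p : ℝ × ℝ => (p.1 : ℂ) :=
      Complex.ofRealCLM.differentiable.comp differentiable_fst
    have h2 : Differentiable ℝ fun p : ℝ × ℝ => (p.2 : ℂ) :=
      Complex.ofRealCLM.differentiable.comp differentiable_snd
    exact ((h1.add (h2.mul_const Complex.I)).const_mul k).cexp
  have hfd : ∀ p ∈ D, HasFDerivAt (N ∘ E) (0 : ℝ × ℝ →L[ℝ] ℂ) p := by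
    intro p hp
    have h1 := ((hNd _ (hEne p hp)).hasFDerivAt.restrictScalars ℝ).comp p (hEd p).hasFDerivAt
    refine h1.congr_fderiv ?_
    ext <;> simp
  obtain ⟨κ, hκ⟩ := hDo.exists_is_const_of_fderiv_eq_zero (𝕜 := ℝ) hD
    (fun p hp => (hfd p hp).differentiableAt.differentiableWithinAt) (fun p hp => (hfd p hp).fderiv)
  have hnorm : ∀ y : ℝ, ‖E (0, y)‖ = Real.exp (-(Real.pi / L * y)) := by
    intro y
    simp only [hE, Complex.norm_exp]
    congr 1
    have : k * (((0 : ℝ) : ℂ) + (y : ℂ) * Complex.I) = ((-(Real.pi / L * y) : ℝ) : ℂ) := by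
      rw [hk]; push_cast
      linear_combination (Real.pi / L * y : ℂ) * Complex.I_mul_I
    rw [this, Complex.ofReal_re]
  have hscale : Tendsto (fun y : ℝ => Real.pi / L * y) atTop atTop :=
    tendsto_id.const_mul_atTop (by positivity)
  have hzero : Tendsto (fun y : ℝ => E (0, y)) atTop (𝓝 0) := by
    rw [tendsto_zero_iff_norm_tendsto_zero]
    simp only [hnorm]
    exact Real.tendsto_exp_neg_atTop_nhds_zero.comp hscale
  have hinf : Tendsto (fun y : ℝ => ‖E (0, -y)‖) atTop atTop := by
    simp only [hnorm, mul_neg, neg_neg]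
    exact Real.tendsto_exp_atTop.comp hscale
  have hκ0 : κ = 0 := by
    refine tendsto_nhds_unique (f := fun _ : ℝ => κ) tendsto_const_nhds
      ((tendsto_integral_closed_curve hT.le hcc hc'c hinf).congr' ?_)
    filter_upwards [eventually_gt_atTop (-a)] with y hy
    exact hκ (0, -y) (hlow _ (by simp only; linarith))
  have hcne : ∀ t, c t ≠ 0 := fun t => Complex.exp_ne_zero _
  have h0 : (0 : ℂ) ∉ c '' Icc 0 T := by
    rintro ⟨s, -, hs⟩
    exact hcne s hs
  have hκN : κ = N 0 := by
    refine tendsto_nhds_unique (f := fun _ : ℝ => κ) tendsto_const_nhds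
      (((hNd 0 h0).continuousAt.tendsto.comp hzero).congr' ?_)
    filter_upwards [eventually_gt_atTop b] with y hy
    exact hκ (0, y) (hup _ hy)
  have hN0 : N 0 = 2 * Real.pi * Complex.I := by
    have : N 0 = ∫ t in (0 : ℝ)..T, ζ' t := by
      refine intervalIntegral.integral_congr fun t _ => ?_
      simp only [hc'def, sub_zero]
      exact mul_div_cancel_left₀ _ (hcne t)
    rw [this, intervalIntegral.integral_eq_sub_of_hasDerivAt (fun t _ => hζ t)
      (hζ'c.intervalIntegrable _ _)]
    have h1 := hXper 0
    have h2 := hYper 0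
    rw [zero_add] at h1 h2
    rw [h1, h2]
    push_cast
    linear_combination hkL
  rw [← hκN, hκ0] at hN0
  simp [hpi] at hN0

theorem hasDerivAt_slice_x {f : ℝ × ℝ → ℝ} {x y : ℝ} (hf : DifferentiableAt ℝ f (x, y)) :
    HasDerivAt (fun t => f (t, y)) (pdX f (x, y)) x := by
  have h : HasDerivAt (fun t : ℝ => (t, y)) ((1 : ℝ), (0 : ℝ)) x :=
    (hasDerivAt_id x).prodMk (hasDerivAt_const x y)
  exact hf.hasFDerivAt.comp_hasDerivAt x h

theorem hasDerivAt_slice_y {f : ℝ × ℝ → ℝ} {x y : ℝ} (hf : DifferentiableAt ℝ f (x, y)) :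
    HasDerivAt (fun t => f (x, t)) (pdY f (x, y)) y := by
  have h : HasDerivAt (fun t : ℝ => (x, t)) ((0 : ℝ), (1 : ℝ)) y :=
    (hasDerivAt_const y x).prodMk (hasDerivAt_id y)
  exact hf.hasFDerivAt.comp_hasDerivAt y h

theorem fderiv_eq_zero_of_pd {f : ℝ × ℝ → ℝ} {p : ℝ × ℝ} (hx : pdX f p = 0) (hy : pdY f p = 0) :
    fderiv ℝ f p = 0 := by
  ext
  · simpa [pdX] using hx
  · simpa [pdY] using hy

theorem contDiff_pdX {f : ℝ × ℝ → ℝ} {n m : WithTop ℕ∞} (hf : ContDiff ℝ n f) (hm : m + 1 ≤ n) :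
    ContDiff ℝ m (pdX f) :=
  (hf.fderiv_right hm).clm_apply contDiff_const

theorem contDiff_pdY {f : ℝ × ℝ → ℝ} {n m : WithTop ℕ∞} (hf : ContDiff ℝ n f) (hm : m + 1 ≤ n) :
    ContDiff ℝ m (pdY f) :=
  (hf.fderiv_right hm).clm_apply contDiff_const

open Filter Topology in
/-- A function with positive derivative at `a` is larger than `f a` just to the right of `a`. -/
theorem HasDerivAt.eventually_lt_nhdsGT {f : ℝ → ℝ} {f' a : ℝ} (hf : HasDerivAt f f' a)
    (hf' : 0 < f') : ∀ᶠ t in 𝓝[>] a, f a < f t := by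
  have h := (hasDerivAt_iff_tendsto_slope.1 hf).mono_left
    (nhdsWithin_mono a (fun t (ht : a < t) => ht.ne'))
  filter_upwards [h.eventually_const_lt hf', self_mem_nhdsWithin] with t h1 (h2 : a < t)
  rw [slope_def_field] at h1
  have := (div_pos_iff_of_pos_right (sub_pos.2 h2)).1 h1
  linarith

open Filter Topology in
/-- The second derivative is nonpositive at a local maximum. -/
theorem IsLocalMax.deriv_deriv_nonpos {f : ℝ → ℝ} {a : ℝ} (h : IsLocalMax f a)
    (hc : ContinuousAt f a) : deriv (deriv f) a ≤ 0 := by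
  by_contra! hpos
  have hmin := isLocalMin_of_deriv_deriv_pos hpos h.deriv_eq_zero hc
  have heq : f =ᶠ[𝓝 a] fun _ => f a := by
    filter_upwards [h, hmin] with t h1 h2 using le_antisymm h1 h2
  have h2 : deriv f =ᶠ[𝓝 a] fun _ => 0 := by
    simpa using heq.deriv
  have := h2.deriv_eq
  simp [this] at hpos

open Filter Topology in
/-- First and second order conditions at a local maximum in the plane. -/
theorem IsLocalMax.pd_conditions {V : ℝ × ℝ → ℝ} {p : ℝ × ℝ} (hV : ContDiff ℝ 2 V)
    (h : IsLocalMax V p) :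
    pdX V p = 0 ∧ pdY V p = 0 ∧ pdX (pdX V) p ≤ 0 ∧ pdY (pdY V) p ≤ 0 := by
  obtain ⟨x, y⟩ := p
  have hd : Differentiable ℝ V := hV.differentiable two_ne_zero
  have hX : Differentiable ℝ (pdX V) :=
    (contDiff_pdX hV (m := 1) (by norm_num)).differentiable one_ne_zero
  have hY : Differentiable ℝ (pdY V) :=
    (contDiff_pdY hV (m := 1) (by norm_num)).differentiable one_ne_zero
  have hfd : fderiv ℝ V (x, y) = 0 := h.fderiv_eq_zero
  refine ⟨by simp [pdX, hfd], by simp [pdY, hfd], ?_, ?_⟩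
  · have h1 : IsLocalMax (fun t => V (t, y)) x :=
      (show Tendsto (fun t : ℝ => (t, y)) (𝓝 x) (𝓝 (x, y)) from
        (Continuous.prodMk_left y).tendsto x).eventually h
    have h2 := h1.deriv_deriv_nonpos (hasDerivAt_slice_x (hd _)).continuousAt
    have h3 : deriv (fun t => V (t, y)) = fun t => pdX V (t, y) :=
      funext fun t => (hasDerivAt_slice_x (hd _)).deriv
    rwa [h3, (hasDerivAt_slice_x (hX _)).deriv] at h2
  · have h1 : IsLocalMax (fun t => V (x, t)) y :=
      (show Tendsto (fun t : ℝ => (x, t)) (𝓝 y) (𝓝 (x, y)) from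
        (Continuous.prodMk_right x).tendsto y).eventually h
    have h2 := h1.deriv_deriv_nonpos (hasDerivAt_slice_y (hd _)).continuousAt
    have h3 : deriv (fun t => V (x, t)) = fun t => pdY V (x, t) :=
      funext fun t => (hasDerivAt_slice_y (hd _)).deriv
    rwa [h3, (hasDerivAt_slice_y (hY _)).deriv] at h2

open Filter Topology Asymptotics in
/-- The product of a differentiable function vanishing at `p` with a merely continuous function is
differentiable at `p`. -/
theorem HasFDerivAt.mul_of_continuousAt {f h : ℝ × ℝ → ℝ} {f' : ℝ × ℝ →L[ℝ] ℝ} {p : ℝ × ℝ}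
    (hf : HasFDerivAt f f' p) (hf0 : f p = 0) (hh : ContinuousAt h p) :
    HasFDerivAt (fun q => f q * h q) (h p • f') p := by
  rw [hasFDerivAt_iff_isLittleO]
  have h1 : (fun q => (h q - h p) * f q) =o[𝓝 p] fun q => q - p := by
    have h2 : (fun q => h q - h p) =o[𝓝 p] fun _ => (1 : ℝ) := by
      rw [isLittleO_one_iff]
      simpa using hh.tendsto.sub_const (h p)
    have h3 : f =O[𝓝 p] fun q => ‖q - p‖ := by
      have := hf.isBigO_sub
      simpa [hf0] using this.norm_right
    simpa using h2.mul_isBigO h3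
  have h4 := (hasFDerivAt_iff_isLittleO.1 hf).const_mul_left (h p)
  refine (h1.add h4).congr_left fun q => ?_
  simp [hf0]
  ring

open Filter Topology Asymptotics in
/-- If a vector field, differentiable at `p`, has vanishing outward increments on suitable points of
arbitrarily small squares around `p`, then its divergence at `p` vanishes. -/
theorem divergence_eq_zero_of_squares {N₁ N₂ : ℝ × ℝ → ℝ} {l₁ l₂ : ℝ × ℝ →L[ℝ] ℝ} {x y : ℝ}
    (h₁ : HasFDerivAt N₁ l₁ (x, y)) (h₂ : HasFDerivAt N₂ l₂ (x, y))
    (hsq : ∀ᶠ r in 𝓝[>] (0 : ℝ), ∃ t ∈ Ioo (-1 : ℝ) 1,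
      N₁ (x + r, y + r * t) - N₁ (x - r, y + r * t)
        + (N₂ (x + r * t, y + r) - N₂ (x + r * t, y - r)) = 0) :
    l₁ (1, 0) + l₂ (0, 1) = 0 := by
  set A := l₁ (1, 0) + l₂ (0, 1) with hA
  by_contra hne
  have hε : 0 < |A| / 4 := by positivity
  have e₁ := (hasFDerivAt_iff_isLittleO.1 h₁).def hε
  have e₂ := (hasFDerivAt_iff_isLittleO.1 h₂).def hε
  obtain ⟨δ, hδ, hball⟩ := Metric.eventually_nhds_iff.1 (e₁.and e₂)
  obtain ⟨r, ⟨t, ht, h0⟩, hr, hrδ⟩ := (hsq.and (Ioo_mem_nhdsGT hδ)).exists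
  have habs : |t| < 1 := abs_lt.2 ht
  have hrt : |r * t| ≤ r := by
    rw [abs_mul, abs_of_pos hr]
    nlinarith
  have hnorm : ∀ a b : ℝ, |a| = r → |b| ≤ r → ‖((a, b) : ℝ × ℝ)‖ = r := fun a b ha hb => by
    rw [Prod.norm_mk, Real.norm_eq_abs, Real.norm_eq_abs, ha, max_eq_left hb]
  have hnorm' : ∀ a b : ℝ, |a| ≤ r → |b| = r → ‖((a, b) : ℝ × ℝ)‖ = r := fun a b ha hb => by
    rw [Prod.norm_mk, Real.norm_eq_abs, Real.norm_eq_abs, hb, max_eq_right ha]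
  have hest : ∀ z : ℝ × ℝ, ‖z‖ = r →
      |N₁ ((x, y) + z) - N₁ (x, y) - l₁ z| ≤ |A| / 4 * r ∧
      |N₂ ((x, y) + z) - N₂ (x, y) - l₂ z| ≤ |A| / 4 * r := by
    intro z hz
    have := @hball ((x, y) + z) (by rw [dist_eq_norm, add_sub_cancel_left, hz]; exact hrδ)
    rw [add_sub_cancel_left, hz] at this
    exact this
  have hr' : |r| = r := abs_of_pos hr
  have E1 := (hest (r, r * t) (hnorm _ _ hr' hrt)).1
  have E2 := (hest (-r, r * t) (hnorm _ _ (by rw [abs_neg, hr']) hrt)).1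
  have E3 := (hest (r * t, r) (hnorm' _ _ hrt hr')).2
  have E4 := (hest (r * t, -r) (hnorm' _ _ hrt (by rw [abs_neg, hr']))).2
  have hl : ∀ (l : ℝ × ℝ →L[ℝ] ℝ) (a b : ℝ), l (a, b) = a * l (1, 0) + b * l (0, 1) := by
    intro l a b
    have : ((a, b) : ℝ × ℝ) = a • (1, 0) + b • (0, 1) := by simp
    rw [this, map_add, map_smul, map_smul, smul_eq_mul, smul_eq_mul]
  rw [hl l₁ r] at E1
  rw [hl l₁ (-r)] at E2
  rw [hl l₂ (r * t)] at E3 E4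
  simp only [Prod.mk_add_mk, ← sub_eq_add_neg] at E1 E2 E3 E4
  rw [abs_le] at E1 E2 E3 E4
  have hup : r * (2 * A) ≤ r * |A| := by rw [hA] at *; nlinarith
  have hlo : -(r * |A|) ≤ r * (2 * A) := by rw [hA] at *; nlinarith
  have hup' : 2 * A ≤ |A| := le_of_mul_le_mul_left hup hr
  have hlo' : -|A| ≤ 2 * A := by
    refine le_of_mul_le_mul_left (?_ : r * -|A| ≤ _) hr
    linarith
  rcases abs_cases A with ⟨h, h'⟩ | ⟨h, h'⟩
  · exact hne (by linarith)
  · linarith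

open Filter Topology in
/-- The pressure Poisson equation for a `C¹` divergence-free flow with `C²` potential `W`, where the
second derivatives of the velocity need not exist. -/
theorem laplacian_of_advection {u v W : ℝ × ℝ → ℝ} {Ω : Set (ℝ × ℝ)} (hΩ : IsOpen Ω)
    (hu : ContDiff ℝ 1 u) (hv : ContDiff ℝ 1 v) (hW : ContDiff ℝ 2 W)
    (hx : ∀ p ∈ Ω, u p * pdX u p + v p * pdY u p = -pdX W p)
    (hy : ∀ p ∈ Ω, u p * pdX v p + v p * pdY v p = -pdY W p)
    (hdiv : ∀ p ∈ Ω, pdX u p + pdY v p = 0) {p : ℝ × ℝ} (hp : p ∈ Ω) :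
    pdX (pdX W) p + pdY (pdY W) p = -(pdX u p ^ 2 + 2 * pdY u p * pdX v p + pdY v p ^ 2) := by
  obtain ⟨x, y⟩ := p
  have hud : Differentiable ℝ u := hu.differentiable one_ne_zero
  have hvd : Differentiable ℝ v := hv.differentiable one_ne_zero
  have hWX : Differentiable ℝ (pdX W) :=
    (contDiff_pdX hW (m := 1) (by norm_num)).differentiable one_ne_zero
  have hWY : Differentiable ℝ (pdY W) :=
    (contDiff_pdY hW (m := 1) (by norm_num)).differentiable one_ne_zero
  have huX : Continuous (pdX u) := (contDiff_pdX hu (m := 0) (by norm_num)).continuous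
  have huY : Continuous (pdY u) := (contDiff_pdY hu (m := 0) (by norm_num)).continuous
  have hvX : Continuous (pdX v) := (contDiff_pdX hv (m := 0) (by norm_num)).continuous
  have hvY : Continuous (pdY v) := (contDiff_pdY hv (m := 0) (by norm_num)).continuous
  have hΩn : Ω ∈ 𝓝 (x, y) := hΩ.mem_nhds hp
  set u₀ := u (x, y) with hu₀
  set v₀ := v (x, y) with hv₀
  have du : HasFDerivAt (fun q => u q - u₀) (fderiv ℝ u (x, y)) (x, y) :=
    (hud _).hasFDerivAt.sub_const u₀
  have dv : HasFDerivAt (fun q => v q - v₀) (fderiv ℝ v (x, y)) (x, y) :=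
    (hvd _).hasFDerivAt.sub_const v₀
  have D₁ : HasFDerivAt (fun q => -(u₀ * pdX u q + v₀ * pdY u q)) _ (x, y) :=
    (((hWX (x, y)).hasFDerivAt.add
      (du.mul_of_continuousAt (by simp [hu₀]) huX.continuousAt)).add
      (dv.mul_of_continuousAt (by simp [hv₀]) huY.continuousAt)).congr_of_eventuallyEq (by
        filter_upwards [hΩn] with q hq
        have := hx q hq
        simp only [Pi.add_apply]
        linarith)
  have D₂ : HasFDerivAt (fun q => -(u₀ * pdX v q + v₀ * pdY v q)) _ (x, y) :=
    (((hWY (x, y)).hasFDerivAt.add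
      (du.mul_of_continuousAt (by simp [hu₀]) hvX.continuousAt)).add
      (dv.mul_of_continuousAt (by simp [hv₀]) hvY.continuousAt)).congr_of_eventuallyEq (by
        filter_upwards [hΩn] with q hq
        have := hy q hq
        simp only [Pi.add_apply]
        linarith)
  have key := divergence_eq_zero_of_squares D₁ D₂ ?_
  · simp only [add_apply, smul_apply, smul_eq_mul] at key
    change pdX (pdX W) (x, y) + pdX u (x, y) * pdX u (x, y) + pdY u (x, y) * pdX v (x, y)
      + (pdY (pdY W) (x, y) + pdX v (x, y) * pdY u (x, y) + pdY v (x, y) * pdY v (x, y)) = 0 at key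
    linarith
  · obtain ⟨δ, hδ, hball⟩ := Metric.mem_nhds_iff.1 hΩn
    filter_upwards [Ioo_mem_nhdsGT hδ] with r hr
    have hmem : ∀ a b : ℝ, |a| ≤ r → |b| ≤ r → (x + a, y + b) ∈ Ω := by
      intro a b ha hb
      apply hball
      rw [Metric.mem_ball, dist_eq_norm, Prod.mk_sub_mk, add_sub_cancel_left, add_sub_cancel_left,
        Prod.norm_mk]
      exact max_lt (ha.trans_lt hr.2) (hb.trans_lt hr.2)
    have sx : ∀ {f : ℝ × ℝ → ℝ}, Differentiable ℝ f → ∀ c t : ℝ,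
        HasDerivAt (fun t => f (x + r * t, c)) (pdX f (x + r * t, c) * r) t := by
      intro f hf c t
      have h1 : HasDerivAt (fun t : ℝ => x + r * t) r t := by
        simpa using ((hasDerivAt_id t).const_mul r).const_add x
      exact (hasDerivAt_slice_x (hf (x + r * t, c))).comp t h1
    have sy : ∀ {f : ℝ × ℝ → ℝ}, Differentiable ℝ f → ∀ c t : ℝ,
        HasDerivAt (fun t => f (c, y + r * t)) (pdY f (c, y + r * t) * r) t := by
      intro f hf c t
      have h1 : HasDerivAt (fun t : ℝ => y + r * t) r t := by
        simpa using ((hasDerivAt_id t).const_mul r).const_add y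
      exact (hasDerivAt_slice_y (hf (c, y + r * t))).comp t h1
    have dΦ := fun t : ℝ =>
      (((((sy hvd (x - r) t).fun_sub (sy hvd (x + r) t)).fun_add (sx hvd (y + r) t)).fun_sub
        (sx hvd (y - r) t)).const_mul u₀).fun_add
      (((((sy hud (x + r) t).fun_sub (sy hud (x - r) t)).fun_sub (sx hud (y + r) t)).fun_add
        (sx hud (y - r) t)).const_mul v₀)
    obtain ⟨t, ht, h0⟩ := exists_hasDerivAt_eq_zero (show (-1 : ℝ) < 1 by norm_num)
      (fun t _ => (dΦ t).continuousAt.continuousWithinAt)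
      (by simp only [mul_neg, mul_one, ← sub_eq_add_neg]; ring) (fun t _ => dΦ t)
    refine ⟨t, ht, ?_⟩
    have hrt : |r * t| ≤ r := by
      rw [abs_mul, abs_of_pos hr.1]
      have : |t| < 1 := abs_lt.2 ht
      nlinarith [hr.1]
    have hr' : |r| ≤ r := (abs_of_pos hr.1).le
    have hr'' : |-r| ≤ r := by rw [abs_neg]; exact hr'
    have i1 := hdiv _ (hmem r (r * t) hr' hrt)
    have i2 := hdiv _ (hmem (-r) (r * t) hr'' hrt)
    have i3 := hdiv _ (hmem (r * t) r hrt hr')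
    have i4 := hdiv _ (hmem (r * t) (-r) hrt hr'')
    simp only [← sub_eq_add_neg] at i2 i4
    have hr0 : r ≠ 0 := hr.1.ne'
    apply mul_left_cancel₀ hr0
    linear_combination -h0 - r * u₀ * (i1 - i2) + r * v₀ * (i4 - i3)

theorem pdX_eq_of_hasDerivAt {f : ℝ × ℝ → ℝ} {x y c : ℝ} (hf : DifferentiableAt ℝ f (x, y))
    (h : HasDerivAt (fun t => f (t, y)) c x) : pdX f (x, y) = c :=
  (hasDerivAt_slice_x hf).unique h

theorem pdY_eq_of_hasDerivAt {f : ℝ × ℝ → ℝ} {x y c : ℝ} (hf : DifferentiableAt ℝ f (x, y))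
    (h : HasDerivAt (fun t => f (x, t)) c y) : pdY f (x, y) = c :=
  (hasDerivAt_slice_y hf).unique h

/-- A preconnected set meeting an open set but not its frontier is contained in it. -/
theorem IsPreconnected.subset_of_disjoint_frontier {α : Type*} [TopologicalSpace α] {s t : Set α}
    (hs : IsPreconnected s) (ht : IsOpen t) (hst : (s ∩ t).Nonempty)
    (hfr : ∀ p ∈ s, p ∉ frontier t) : s ⊆ t := by
  refine hs.subset_left_of_subset_union ht isClosed_closure.isOpen_compl
    (disjoint_compl_right.mono_left subset_closure) (fun p hp => ?_) hst
  by_cases h : p ∈ closure t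
  · rw [closure_eq_self_union_frontier] at h
    exact Or.inl (h.resolve_right (hfr p hp))
  · exact Or.inr h

namespace GenPeriodicFlow

variable {g Patm L d : ℝ} (F : GenPeriodicFlow g Patm L d)

theorem isCompact_range_Y : IsCompact (range F.Y) :=
  Function.Periodic.compact_of_continuous F.Y_per F.T_pos.ne' F.Y_smooth.continuous

theorem Y_le_maxη (s : ℝ) : F.Y s ≤ F.maxη :=
  le_csSup F.isCompact_range_Y.bddAbove (mem_range_self s)

theorem minη_le_Y (s : ℝ) : F.minη ≤ F.Y s :=
  csInf_le F.isCompact_range_Y.bddBelow (mem_range_self s)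

theorem bed_lt_minη : -d < F.minη := by
  obtain ⟨s, hs⟩ := F.isCompact_range_Y.sInf_mem (range_nonempty F.Y)
  exact (F.S_above_bed s).trans_eq hs

theorem surface_mem_frontier (s : ℝ) : (F.X s, F.Y s) ∈ frontier F.Ω := by
  rw [F.Ω_frontier]
  exact Or.inl (mem_range_self s)

theorem bed_mem_frontier (x : ℝ) : (x, -d) ∈ frontier F.Ω := by
  rw [F.Ω_frontier]
  exact Or.inr rfl

theorem surface_mem_closure (s : ℝ) : (F.X s, F.Y s) ∈ closure F.Ω :=
  frontier_subset_closure (F.surface_mem_frontier s)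

theorem bed_mem_closure (x : ℝ) : (x, -d) ∈ closure F.Ω :=
  frontier_subset_closure (F.bed_mem_frontier x)

theorem notMem_of_mem_frontier {p : ℝ × ℝ} (hp : p ∈ frontier F.Ω) : p ∉ F.Ω := fun h =>
  (disjoint_frontier_iff_isOpen.2 F.Ω_open).le_bot ⟨hp, h⟩

theorem bed_lt_of_mem {p : ℝ × ℝ} (hp : p ∈ F.Ω) : -d < p.2 := by
  have hlow : IsOpen {q : ℝ × ℝ | q.2 < -d} := isOpen_lt continuous_snd continuous_const
  have hup : IsOpen {q : ℝ × ℝ | -d < q.2} := isOpen_lt continuous_const continuous_snd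
  have hdisj : Disjoint {q : ℝ × ℝ | q.2 < -d} {q : ℝ × ℝ | -d < q.2} :=
    Set.disjoint_left.2 fun q (h1 : q.2 < -d) (h2 : -d < q.2) => lt_asymm h1 h2
  have hcover : F.Ω ⊆ {q : ℝ × ℝ | q.2 < -d} ∪ {q : ℝ × ℝ | -d < q.2} := by
    intro q hq
    rcases lt_trichotomy q.2 (-d) with h | h | h
    · exact Or.inl h
    · exact absurd hq (F.notMem_of_mem_frontier (by rw [F.Ω_frontier]; exact Or.inr h))
    · exact Or.inr h
  obtain ⟨q, hq, hqΩ⟩ := mem_closure_iff.1 (F.surface_mem_closure 0) _ hup (F.S_above_bed 0)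
  exact F.Ω_conn.isPreconnected.subset_right_of_subset_union hlow hup hdisj hcover
    ⟨q, hqΩ, hq⟩ hp

/-- The strip between the bed and the lowest surface level is filled with fluid. -/
theorem mem_of_lt_minη {p : ℝ × ℝ} (h1 : -d < p.2) (h2 : p.2 < F.minη) : p ∈ F.Ω := by
  have hpre : IsPreconnected {q : ℝ × ℝ | q.2 ∈ Ioo (-d) F.minη} :=
    ((convex_Ioo (-d) F.minη).linear_preimage (LinearMap.snd ℝ ℝ ℝ)).isPreconnected
  refine hpre.subset_of_disjoint_frontier F.Ω_open ?_ (fun q hq hfr => ?_) ⟨h1, h2⟩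
  · obtain ⟨q, hq, hqΩ⟩ := mem_closure_iff.1 (F.bed_mem_closure 0) {q : ℝ × ℝ | q.2 < F.minη}
      (isOpen_lt continuous_snd continuous_const) F.bed_lt_minη
    exact ⟨q, ⟨F.bed_lt_of_mem hqΩ, hq⟩, hqΩ⟩
  · rw [F.Ω_frontier] at hfr
    rcases hfr with ⟨s, rfl⟩ | h
    · exact (F.minη_le_Y s).not_gt hq.2
    · exact hq.1.ne' h

/-- The fluid lies below the highest surface level. -/
theorem le_maxη_of_mem (hL : 0 < L) {p : ℝ × ℝ} (hp : p ∈ F.Ω) : p.2 ≤ F.maxη := by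
  by_contra! hlt
  have hup : ∀ q : ℝ × ℝ, F.maxη < q.2 → q ∈ F.Ω := by
    have hpre : IsPreconnected {q : ℝ × ℝ | q.2 ∈ Ioi F.maxη} :=
      ((convex_Ioi F.maxη).linear_preimage (LinearMap.snd ℝ ℝ ℝ)).isPreconnected
    refine fun q hq => hpre.subset_of_disjoint_frontier F.Ω_open ⟨p, hlt, hp⟩ (fun q hq hfr => ?_) hq
    rw [F.Ω_frontier] at hfr
    rcases hfr with ⟨s, rfl⟩ | h
    · exact (F.Y_le_maxη s).not_gt hq
    · have h1 : F.maxη < q.2 := hq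
      have h2 : q.2 = -d := h
      linarith [F.S_above_bed 0, F.Y_le_maxη 0]
  have hlow : IsPreconnected {q : ℝ × ℝ | q.2 ∈ Iio F.minη} :=
    ((convex_Iio F.minη).linear_preimage (LinearMap.snd ℝ ℝ ℝ)).isPreconnected
  have hlowo : IsOpen {q : ℝ × ℝ | q.2 < F.minη} := isOpen_lt continuous_snd continuous_const
  refine false_of_isPreconnected_of_periodic_curve (D := {q : ℝ × ℝ | q.2 < F.minη} ∪ F.Ω)
    (a := F.minη) (b := F.maxη) F.T_pos hL
    (F.X_smooth.of_le (by norm_num)) (F.Y_smooth.of_le (by norm_num)) F.X_per F.Y_per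
    (hlowo.union F.Ω_open) ?_ ?_ (fun q hq => Or.inl hq) (fun q hq => Or.inr (hup q hq))
  · obtain ⟨q, hq, hqΩ⟩ := mem_closure_iff.1 (F.bed_mem_closure 0) _ hlowo F.bed_lt_minη
    exact hlow.union q hq hqΩ F.Ω_conn.isPreconnected
  · rintro s (h | h)
    · exact (F.minη_le_Y s).not_gt h
    · exact F.notMem_of_mem_frontier (F.surface_mem_frontier s) h

theorem mem_closure_bounds (hL : 0 < L) {p : ℝ × ℝ} (hp : p ∈ closure F.Ω) :
    -d ≤ p.2 ∧ p.2 ≤ F.maxη := by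
  have hcl : IsClosed {q : ℝ × ℝ | q.2 ∈ Icc (-d) F.maxη} := isClosed_Icc.preimage continuous_snd
  exact hcl.closure_subset_iff.2 (fun q hq => ⟨(F.bed_lt_of_mem hq).le, F.le_maxη_of_mem hL hq⟩) hp

theorem mem_closure_add_period (p : ℝ × ℝ) :
    (p.1 + 2 * L, p.2) ∈ closure F.Ω ↔ p ∈ closure F.Ω := by
  have h := (Homeomorph.addRight ((2 * L, 0) : ℝ × ℝ)).preimage_closure F.Ω
  have h2 : Homeomorph.addRight ((2 * L, 0) : ℝ × ℝ) ⁻¹' F.Ω = F.Ω := by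
    ext q
    rw [F.Ω_per q]
    simp [Prod.add_def]
  rw [h2] at h
  simpa [Prod.add_def] using Set.ext_iff.1 h p

/-- One period of the closed fluid domain. -/
def cell : Set (ℝ × ℝ) := closure F.Ω ∩ Icc 0 (2 * L) ×ˢ Icc (-d) F.maxη

theorem isCompact_cell : IsCompact F.cell :=
  (isCompact_Icc.prod isCompact_Icc).inter_left isClosed_closure

theorem exists_mem_cell (hL : 0 < L) {f : ℝ × ℝ → ℝ}
    (hper : ∀ p ∈ closure F.Ω, f (p.1 + 2 * L, p.2) = f p) {p : ℝ × ℝ} (hp : p ∈ closure F.Ω) :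
    ∃ q ∈ F.cell, f q = f p := by
  classical
  let G : ℝ → Prop × ℝ := fun x =>
    ((x, p.2) ∈ closure F.Ω, if (x, p.2) ∈ closure F.Ω then f (x, p.2) else 0)
  have hG : Function.Periodic G (2 * L) := by
    intro x
    have h1 := F.mem_closure_add_period (x, p.2)
    by_cases h : (x, p.2) ∈ closure F.Ω
    · have h2 := hper _ h
      simp only at h1 h2
      simp [G, h, h1, h2]
    · simp only at h1
      simp [G, h, h1]
  obtain ⟨x, hx, hxp⟩ := hG.exists_mem_Ico₀ (by positivity) p.1
  have hmem : (x, p.2) ∈ closure F.Ω := by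
    have h1 : ((p.1, p.2) ∈ closure F.Ω) = ((x, p.2) ∈ closure F.Ω) := congrArg Prod.fst hxp
    exact h1 ▸ hp
  refine ⟨(x, p.2), ⟨hmem, ⟨hx.1, hx.2.le⟩, F.mem_closure_bounds hL hmem⟩, ?_⟩
  have h2 := congrArg Prod.snd hxp
  simp only [G] at h2
  rw [if_pos hmem, if_pos hp] at h2
  exact h2.symm

theorem exists_max (hL : 0 < L) {f : ℝ × ℝ → ℝ} (hf : Continuous f)
    (hper : ∀ p ∈ closure F.Ω, f (p.1 + 2 * L, p.2) = f p) :
    ∃ p ∈ F.cell, ∀ q ∈ closure F.Ω, f q ≤ f p := by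
  obtain ⟨z, hz⟩ := F.Ω_conn.nonempty
  obtain ⟨w, hw, -⟩ := F.exists_mem_cell hL hper (subset_closure hz)
  obtain ⟨p, hp, hmax⟩ := F.isCompact_cell.exists_isMaxOn ⟨w, hw⟩ hf.continuousOn
  refine ⟨p, hp, fun q hq => ?_⟩
  obtain ⟨q', hq', he⟩ := F.exists_mem_cell hL hper hq
  exact he ▸ hmax hq'

open Filter Topology in
theorem exists_lt_of_pdY_bed_pos {f : ℝ × ℝ → ℝ} (hf : Differentiable ℝ f) {x : ℝ}
    (h : 0 < pdY f (x, -d)) : ∃ q ∈ F.Ω, f (x, -d) < f q := by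
  obtain ⟨t, h1, h2⟩ := ((hasDerivAt_slice_y (hf _)).eventually_lt_nhdsGT h |>.and
    (Ioo_mem_nhdsGT F.bed_lt_minη)).exists
  exact ⟨(x, t), F.mem_of_lt_minη h2.1 h2.2, h1⟩

theorem mem_closure_cases {p : ℝ × ℝ} (hp : p ∈ closure F.Ω) :
    p ∈ F.Ω ∨ (∃ s, p = (F.X s, F.Y s)) ∨ ∃ x, p = (x, -d) := by
  rw [closure_eq_self_union_frontier, F.Ω_frontier] at hp
  rcases hp with h | ⟨s, hs⟩ | h
  · exact Or.inl h
  · exact Or.inr (Or.inl ⟨s, hs.symm⟩)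
  · exact Or.inr (Or.inr ⟨p.1, Prod.ext rfl h⟩)

theorem isLocalMax_of_mem {f : ℝ × ℝ → ℝ} {p : ℝ × ℝ} (hp : p ∈ F.Ω)
    (h : ∀ q ∈ closure F.Ω, f q ≤ f p) : IsLocalMax f p := by
  filter_upwards [F.Ω_open.mem_nhds hp] with q hq using h q (subset_closure hq)

/-- A function without interior maxima that increases away from the bed is bounded by its values
on the free surface. -/
theorem le_of_surface_le (hL : 0 < L) {f : ℝ × ℝ → ℝ} {C : ℝ} (hf : Differentiable ℝ f)
    (hper : ∀ p ∈ closure F.Ω, f (p.1 + 2 * L, p.2) = f p)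
    (hint : ∀ p ∈ F.cell, p ∈ F.Ω → ¬IsLocalMax f p) (hbed : ∀ x, 0 < pdY f (x, -d))
    (hsurf : ∀ s, f (F.X s, F.Y s) ≤ C) {q : ℝ × ℝ} (hq : q ∈ closure F.Ω) : f q ≤ C := by
  obtain ⟨p, hp, hmax⟩ := F.exists_max hL hf.continuous hper
  rcases F.mem_closure_cases hp.1 with h | ⟨s, rfl⟩ | ⟨x, rfl⟩
  · exact absurd (F.isLocalMax_of_mem h hmax) (hint p hp h)
  · exact (hmax q hq).trans (hsurf s)
  · obtain ⟨z, hz, hlt⟩ := F.exists_lt_of_pdY_bed_pos hf (hbed x)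
    exact absurd (hmax z (subset_closure hz)) hlt.not_ge

theorem differentiable_u : Differentiable ℝ F.u := F.u_smooth.differentiable one_ne_zero

theorem differentiable_v : Differentiable ℝ F.v := F.v_smooth.differentiable one_ne_zero

theorem differentiable_P : Differentiable ℝ F.P := F.P_smooth.differentiable two_ne_zero

theorem differentiable_ψ : Differentiable ℝ F.ψ := F.ψ_smooth.differentiable two_ne_zero

theorem continuous_pdX_u : Continuous (pdX F.u) :=
  (contDiff_pdX F.u_smooth (m := 0) (by norm_num)).continuous

theorem continuous_pdY_u : Continuous (pdY F.u) :=
  (contDiff_pdY F.u_smooth (m := 0) (by norm_num)).continuous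

theorem continuous_pdX_v : Continuous (pdX F.v) :=
  (contDiff_pdX F.v_smooth (m := 0) (by norm_num)).continuous

theorem continuous_pdY_v : Continuous (pdY F.v) :=
  (contDiff_pdY F.v_smooth (m := 0) (by norm_num)).continuous

theorem continuous_pdX_P : Continuous (pdX F.P) :=
  (contDiff_pdX F.P_smooth (m := 1) (by norm_num)).continuous

theorem continuous_pdY_P : Continuous (pdY F.P) :=
  (contDiff_pdY F.P_smooth (m := 1) (by norm_num)).continuous

theorem continuous_vort : Continuous F.vort := F.continuous_pdX_v.sub F.continuous_pdY_u

theorem euler_x_closure {p : ℝ × ℝ} (hp : p ∈ closure F.Ω) :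
    F.u p * pdX F.u p + F.v p * pdY F.u p = -pdX F.P p :=
  (isClosed_eq ((F.u_smooth.continuous.mul F.continuous_pdX_u).add
    (F.v_smooth.continuous.mul F.continuous_pdY_u)) F.continuous_pdX_P.neg).closure_subset_iff.2
    F.euler_x hp

theorem euler_y_closure {p : ℝ × ℝ} (hp : p ∈ closure F.Ω) :
    F.u p * pdX F.v p + F.v p * pdY F.v p = -(pdY F.P p) - g :=
  (isClosed_eq ((F.u_smooth.continuous.mul F.continuous_pdX_v).add
    (F.v_smooth.continuous.mul F.continuous_pdY_v))
    (F.continuous_pdY_P.neg.sub continuous_const)).closure_subset_iff.2 F.euler_y hp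

theorem vort_nonpos_closure (hω : ∀ p ∈ F.Ω, F.vort p ≤ 0) {p : ℝ × ℝ} (hp : p ∈ closure F.Ω) :
    F.vort p ≤ 0 :=
  (isClosed_le F.continuous_vort continuous_const).closure_subset_iff.2 hω hp

theorem ψ_periodic {p : ℝ × ℝ} (hp : p ∈ closure F.Ω) :
    F.ψ (p.1 + 2 * L, p.2) = F.ψ p := by
  set D : ℝ × ℝ → ℝ := fun q => F.ψ (q + (2 * L, 0)) - F.ψ q with hD
  have hsh : Differentiable ℝ fun q => F.ψ (q + (2 * L, 0)) :=
    F.differentiable_ψ.comp (differentiable_id.add_const _)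
  have hDd : Differentiable ℝ D := hsh.sub F.differentiable_ψ
  have hadd : ∀ q : ℝ × ℝ, q + (2 * L, 0) = (q.1 + 2 * L, q.2) := fun q => by simp [Prod.add_def]
  have hfd : ∀ q, fderiv ℝ D q = fderiv ℝ F.ψ (q + (2 * L, 0)) - fderiv ℝ F.ψ q := fun q => by
    rw [hD, fderiv_fun_sub (hsh q) (F.differentiable_ψ q), fderiv_comp_add_right]
  obtain ⟨c, hc⟩ := F.Ω_open.exists_is_const_of_fderiv_eq_zero (𝕜 := ℝ) F.Ω_conn.isPreconnected
    hDd.differentiableOn (fun q hq => by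
      have hq2 : q + (2 * L, 0) ∈ closure F.Ω := by
        rw [hadd, F.mem_closure_add_period]
        exact subset_closure hq
      have x1 := F.psi_x _ hq2
      have x2 := F.psi_x _ (subset_closure hq)
      have y1 := F.psi_y _ hq2
      have y2 := F.psi_y _ (subset_closure hq)
      rw [hadd] at x1 y1
      rw [F.v_periodic] at x1
      rw [F.u_periodic] at y1
      refine fderiv_eq_zero_of_pd ?_ ?_
      · rw [pdX, hfd, sub_apply, hadd]
        exact sub_eq_zero.2 (x1.trans x2.symm)
      · rw [pdY, hfd, sub_apply, hadd]
        exact sub_eq_zero.2 (y1.trans y2.symm))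
  have hcl : ∀ q ∈ closure F.Ω, D q = c := fun q hq =>
    (isClosed_eq hDd.continuous continuous_const).closure_subset_iff.2 hc hq
  have hc0 : c = 0 := by
    rw [← hcl _ (F.surface_mem_closure 0)]
    simp only [hD, hadd]
    rw [← F.X_per, F.psi_surface, ← F.Y_per, F.psi_surface, sub_zero]
  have := hcl p hp
  rw [hc0, hD] at this
  simp only [hadd] at this
  linarith

open Filter Topology in
/-- Below a trough where the flow is directed to the left the stream function is positive. -/
theorem exists_ψ_pos_of_trough {s : ℝ} (hs : F.Y s = F.minη) (hu : F.u (F.X s, F.Y s) < 0) :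
    ∃ q ∈ closure F.Ω, 0 < F.ψ q := by
  have h1 : HasDerivAt (fun t : ℝ => F.Y s - t) (-1) 0 := (hasDerivAt_id 0).const_sub _
  have h2 : HasDerivAt (fun t => F.ψ (F.X s, F.Y s - t)) (-F.u (F.X s, F.Y s)) 0 := by
    have h3 := hasDerivAt_slice_y (F.differentiable_ψ (F.X s, F.Y s))
    rw [F.psi_y _ (F.surface_mem_closure s)] at h3
    have h4 := HasDerivAt.comp_of_eq (0 : ℝ) h3 h1 (sub_zero _).symm
    simpa [Function.comp_def] using h4
  obtain ⟨t, h3, h4⟩ := ((h2.eventually_lt_nhdsGT (by linarith)).and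
    (Ioo_mem_nhdsGT (by linarith [F.S_above_bed s] : (0 : ℝ) < F.Y s + d))).exists
  rw [sub_zero, F.psi_surface] at h3
  refine ⟨_, subset_closure (F.mem_of_lt_minη ?_ ?_), h3⟩
  · simp only
    linarith [h4.2]
  · simp only
    linarith [h4.1]

/-- Near a crest where the flow is directed to the left the stream function is positive. -/
theorem exists_ψ_pos_of_crest (hL : 0 < L) {s : ℝ} (hs : F.Y s = F.maxη)
    (hu : F.u (F.X s, F.Y s) < 0) : ∃ q ∈ closure F.Ω, 0 < F.ψ q := by
  have hcont : Continuous (pdY F.ψ) :=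
    (contDiff_pdY F.ψ_smooth (m := 1) (by norm_num)).continuous
  have hneg : pdY F.ψ (F.X s, F.Y s) < 0 := by rwa [F.psi_y _ (F.surface_mem_closure s)]
  obtain ⟨δ, hδ, hball⟩ := Metric.isOpen_iff.1 (isOpen_lt hcont continuous_const) _ hneg
  obtain ⟨⟨x, y⟩, hpb, hpΩ⟩ := mem_closure_iff.1 (F.surface_mem_closure s) _ Metric.isOpen_ball
    (Metric.mem_ball_self hδ)
  refine ⟨(x, y), subset_closure hpΩ, ?_⟩
  have hy : y ≤ F.maxη := F.le_maxη_of_mem hL hpΩ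
  have htop : (x, F.maxη) ∉ F.Ω := by
    intro h
    obtain ⟨r, hr, hb⟩ := Metric.isOpen_iff.1 F.Ω_open _ h
    have h1 : (x, F.maxη + r / 2) ∈ F.Ω := by
      apply hb
      simp only [Metric.mem_ball, dist_eq_norm, Prod.mk_sub_mk, sub_self, add_sub_cancel_left,
        Prod.norm_mk, norm_zero, Real.norm_eq_abs]
      rw [abs_of_pos (half_pos hr)]
      exact max_lt hr (half_lt_self hr)
    have h2 := F.le_maxη_of_mem hL h1
    simp only at h2
    linarith
  rw [Metric.mem_ball, dist_eq_norm, Prod.mk_sub_mk, Prod.norm_mk, max_lt_iff, Real.norm_eq_abs,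
    Real.norm_eq_abs, hs] at hpb
  have hseg : ∀ t ∈ Icc y F.maxη, pdY F.ψ (x, t) < 0 := by
    intro t ht
    refine hball (show (x, t) ∈ Metric.ball (F.X s, F.Y s) δ from ?_)
    rw [Metric.mem_ball, dist_eq_norm, Prod.mk_sub_mk, Prod.norm_mk, max_lt_iff, Real.norm_eq_abs,
      Real.norm_eq_abs, hs]
    refine ⟨hpb.1, lt_of_le_of_lt ?_ hpb.2⟩
    rw [abs_of_nonpos (by linarith [ht.2]), abs_of_nonpos (by linarith)]
    linarith [ht.1]
  have hpre : IsPreconnected ((fun t => (x, t)) '' Icc y F.maxη) :=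
    isPreconnected_Icc.image _ (Continuous.prodMk_right x).continuousOn
  obtain ⟨_, ⟨t, ht, rfl⟩, hfr⟩ : ∃ q ∈ (fun t => (x, t)) '' Icc y F.maxη, q ∈ frontier F.Ω := by
    by_contra! hno
    exact htop (hpre.subset_of_disjoint_frontier F.Ω_open
      ⟨(x, y), ⟨y, left_mem_Icc.2 hy, rfl⟩, hpΩ⟩ hno ⟨F.maxη, right_mem_Icc.2 hy, rfl⟩)
  have hyt : y < t := by
    refine lt_of_le_of_ne ht.1 fun h => ?_
    subst h
    exact F.notMem_of_mem_frontier hfr hpΩ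
  have hψt : F.ψ (x, t) = 0 := by
    rw [F.Ω_frontier] at hfr
    rcases hfr with ⟨s', hs'⟩ | h
    · have hst : (F.X s', F.Y s') = (x, t) := hs'
      rw [← hst]
      exact F.psi_surface s'
    · have h1 : t = -d := h
      have h2 : -d < y := F.bed_lt_of_mem hpΩ
      linarith
  have hanti : StrictAntiOn (fun t => F.ψ (x, t)) (Icc y F.maxη) := by
    refine strictAntiOn_of_deriv_neg (convex_Icc _ _)
      (F.differentiable_ψ.continuous.comp (Continuous.prodMk_right x)).continuousOn fun t ht => ?_
    rw [(hasDerivAt_slice_y (F.differentiable_ψ _)).deriv]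
    exact hseg t (interior_subset ht)
  rw [← hψt]
  exact hanti (left_mem_Icc.2 hy) ht hyt

/-- If the stream function is positive somewhere, the flow along the bed is directed to the left. -/
theorem u_bed_neg (hL : 0 < L) (hstag : ∀ p ∈ closure F.Ω, F.u p ^ 2 + F.v p ^ 2 ≠ 0)
    (hpos : ∃ q ∈ closure F.Ω, 0 < F.ψ q) (x : ℝ) : F.u (x, -d) < 0 := by
  obtain ⟨q, hq, hqpos⟩ := hpos
  obtain ⟨p, hp, hmax⟩ := F.exists_max hL F.ψ_smooth.continuous fun _ => F.ψ_periodic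
  have hm : F.ψ p = F.m := by
    rcases F.mem_closure_cases hp.1 with h | ⟨s, rfl⟩ | ⟨x, rfl⟩
    · have hfd := (F.isLocalMax_of_mem h hmax).fderiv_eq_zero
      have h1 := F.psi_x p hp.1
      have h2 := F.psi_y p hp.1
      rw [pdX, hfd, zero_apply] at h1
      rw [pdY, hfd, zero_apply] at h2
      refine absurd ?_ (hstag p hp.1)
      rw [show F.u p = 0 from h2.symm, show F.v p = 0 from neg_eq_zero.1 h1.symm]
      norm_num
    · have := hmax q hq
      rw [F.psi_surface] at this
      linarith
    · exact F.psi_bed x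
  have hb := F.bed_mem_closure x
  have hle : F.u (x, -d) ≤ 0 := by
    by_contra! h
    rw [← F.psi_y _ hb] at h
    obtain ⟨z, hz, hlt⟩ := F.exists_lt_of_pdY_bed_pos F.differentiable_ψ h
    rw [F.psi_bed, ← hm] at hlt
    exact (hmax z (subset_closure hz)).not_gt hlt
  refine lt_of_le_of_ne hle fun h => hstag _ hb ?_
  rw [h, F.bed_kinematic]
  norm_num

/-- The total head `(u² + v²)/2 + P + g y`. -/
noncomputable def head (p : ℝ × ℝ) : ℝ := (F.u p ^ 2 + F.v p ^ 2) / 2 + (F.P p + g * p.2)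

theorem differentiable_head : Differentiable ℝ F.head := by
  have h1 := F.differentiable_u
  have h2 := F.differentiable_v
  have h3 := F.differentiable_P
  change Differentiable ℝ fun p : ℝ × ℝ =>
    (F.u p ^ 2 + F.v p ^ 2) / 2 + (F.P p + g * p.2)
  fun_prop

theorem head_periodic (p : ℝ × ℝ) : F.head (p.1 + 2 * L, p.2) = F.head p := by
  simp only [head, F.u_periodic, F.v_periodic, F.P_periodic]

theorem pdX_head {p : ℝ × ℝ} (hp : p ∈ closure F.Ω) : pdX F.head p = F.vort p * F.v p := by
  obtain ⟨x, y⟩ := p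
  have h := ((((hasDerivAt_slice_x (F.differentiable_u (x, y))).fun_pow 2).fun_add
    ((hasDerivAt_slice_x (F.differentiable_v (x, y))).fun_pow 2)).div_const 2).fun_add
    ((hasDerivAt_slice_x (F.differentiable_P (x, y))).add_const (g * y))
  rw [pdX_eq_of_hasDerivAt (F.differentiable_head _) h, vort]
  have := F.euler_x_closure hp
  simp only [Nat.cast_ofNat, Nat.reduceSub, pow_one]
  linear_combination this

theorem pdY_head {p : ℝ × ℝ} (hp : p ∈ closure F.Ω) : pdY F.head p = -(F.vort p * F.u p) := by
  obtain ⟨x, y⟩ := p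
  have h := ((((hasDerivAt_slice_y (F.differentiable_u (x, y))).fun_pow 2).fun_add
    ((hasDerivAt_slice_y (F.differentiable_v (x, y))).fun_pow 2)).div_const 2).fun_add
    ((hasDerivAt_slice_y (F.differentiable_P (x, y))).fun_add ((hasDerivAt_id y).const_mul g))
  rw [pdY_eq_of_hasDerivAt (F.differentiable_head _) h, vort]
  have := F.euler_y_closure hp
  simp only [Nat.cast_ofNat, Nat.reduceSub, pow_one]
  linear_combination this

/-- Bernoulli's law: the head is constant along the free surface. -/
theorem head_surface (s s' : ℝ) : F.head (F.X s, F.Y s) = F.head (F.X s', F.Y s') := by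
  have h : ∀ s, HasDerivAt (fun s => F.head (F.X s, F.Y s)) 0 s := by
    intro s
    have h1 : HasDerivAt (fun s => (F.X s, F.Y s)) (deriv F.X s, deriv F.Y s) s :=
      (F.X_smooth.differentiable two_ne_zero s).hasDerivAt.prodMk
        (F.Y_smooth.differentiable two_ne_zero s).hasDerivAt
    refine ((F.differentiable_head _).hasFDerivAt.comp_hasDerivAt s h1).congr_deriv ?_
    have h2 : ((deriv F.X s, deriv F.Y s) : ℝ × ℝ)
        = deriv F.X s • ((1, 0) : ℝ × ℝ) + deriv F.Y s • ((0, 1) : ℝ × ℝ) := by simp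
    have hx := F.pdX_head (F.surface_mem_closure s)
    have hy := F.pdY_head (F.surface_mem_closure s)
    rw [pdX] at hx
    rw [pdY] at hy
    rw [h2, map_add, map_smul, map_smul, hx, hy, smul_eq_mul, smul_eq_mul]
    linear_combination -F.vort (F.X s, F.Y s) * F.surface_tangency s
  exact is_const_of_deriv_eq_zero (fun s => (h s).differentiableAt) (fun s => (h s).deriv) s s'

open Filter Topology in
/-- For nonpositive vorticity and leftward flow on the bed, the head is minimal on the surface. -/
theorem head_surface_le (hL : 0 < L) (hstag : ∀ p ∈ closure F.Ω, F.u p ^ 2 + F.v p ^ 2 ≠ 0)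
    (hω : ∀ p ∈ F.Ω, F.vort p ≤ 0) (hbed : ∀ x, F.u (x, -d) < 0) (s : ℝ) {q : ℝ × ℝ}
    (hq : q ∈ closure F.Ω) : F.head (F.X s, F.Y s) ≤ F.head q := by
  have hε : ∀ ε > 0, -(F.head q + ε * F.ψ q) ≤ -F.head (F.X s, F.Y s) := by
    intro ε hε
    have hd : Differentiable ℝ fun p => -(F.head p + ε * F.ψ p) :=
      (F.differentiable_head.add (F.differentiable_ψ.const_mul ε)).neg
    have hX : ∀ p ∈ closure F.Ω,
        pdX (fun p => -(F.head p + ε * F.ψ p)) p = (ε - F.vort p) * F.v p := by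
      rintro ⟨x, y⟩ hp
      rw [pdX_eq_of_hasDerivAt (hd _) ((hasDerivAt_slice_x (F.differentiable_head _)).fun_add
        ((hasDerivAt_slice_x (F.differentiable_ψ _)).const_mul ε)).fun_neg, F.pdX_head hp,
        F.psi_x _ hp]
      ring
    have hY : ∀ p ∈ closure F.Ω,
        pdY (fun p => -(F.head p + ε * F.ψ p)) p = -((ε - F.vort p) * F.u p) := by
      rintro ⟨x, y⟩ hp
      rw [pdY_eq_of_hasDerivAt (hd _) ((hasDerivAt_slice_y (F.differentiable_head _)).fun_add
        ((hasDerivAt_slice_y (F.differentiable_ψ _)).const_mul ε)).fun_neg, F.pdY_head hp,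
        F.psi_y _ hp]
      ring
    have hpos : ∀ p ∈ closure F.Ω, 0 < ε - F.vort p := fun p hp => by
      linarith [F.vort_nonpos_closure hω hp]
    refine F.le_of_surface_le hL hd (fun p hp => ?_) (fun p hp _ hmax => ?_) (fun x => ?_)
      (fun s' => ?_) hq
    · rw [F.head_periodic, F.ψ_periodic hp]
    · have h1 := hX p hp.1
      have h2 := hY p hp.1
      rw [pdX, hmax.fderiv_eq_zero, zero_apply] at h1
      rw [pdY, hmax.fderiv_eq_zero, zero_apply] at h2
      have hne := (hpos p hp.1).ne'
      refine hstag p hp.1 ?_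
      rw [(mul_eq_zero.1 h1.symm).resolve_left hne,
        (mul_eq_zero.1 (neg_eq_zero.1 h2.symm)).resolve_left hne]
      norm_num
    · rw [hY _ (F.bed_mem_closure x)]
      have := mul_neg_of_pos_of_neg (hpos _ (F.bed_mem_closure x)) (hbed x)
      linarith
    · rw [F.psi_surface, F.head_surface s' s]
      simp
  have hlim : Tendsto (fun ε : ℝ => F.head q + ε * F.ψ q) (𝓝[>] 0) (𝓝 (F.head q)) := by
    have : Continuous fun ε : ℝ => F.head q + ε * F.ψ q := by fun_prop
    simpa using (this.tendsto 0).mono_left nhdsWithin_le_nhds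
  refine ge_of_tendsto hlim ?_
  filter_upwards [self_mem_nhdsWithin] with ε h
  linarith [hε ε h]

open Filter Topology in
/-- In the absence of stagnation points, `P + g y` is bounded by its value at the crests. -/
theorem pressure_add_le (hL : 0 < L) (hg : 0 < g)
    (hstag : ∀ p ∈ closure F.Ω, F.u p ^ 2 + F.v p ^ 2 ≠ 0) {q : ℝ × ℝ} (hq : q ∈ closure F.Ω) :
    F.P q + g * q.2 ≤ Patm + g * F.maxη := by
  set W : ℝ × ℝ → ℝ := fun p => F.P p + g * p.2 with hW
  have hWc : ContDiff ℝ 2 W := F.P_smooth.add (contDiff_const.mul contDiff_snd)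
  have hWd : Differentiable ℝ W := hWc.differentiable two_ne_zero
  have hWX : ∀ p, pdX W p = pdX F.P p := by
    rintro ⟨x, y⟩
    exact pdX_eq_of_hasDerivAt (hWd _)
      ((hasDerivAt_slice_x (F.differentiable_P (x, y))).add_const (g * y))
  have hWY : ∀ p, pdY W p = pdY F.P p + g := by
    rintro ⟨x, y⟩
    rw [pdY_eq_of_hasDerivAt (hWd _) ((hasDerivAt_slice_y (F.differentiable_P (x, y))).fun_add
      ((hasDerivAt_id y).const_mul g)), mul_one]
  have hWYd : Differentiable ℝ (pdY W) :=
    (contDiff_pdY hWc (m := 1) (by norm_num)).differentiable one_ne_zero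
  set B : ℝ × ℝ → ℝ := fun p =>
    2 * (pdY W p + F.vort p * F.u p) / (F.u p ^ 2 + F.v p ^ 2) with hB
  obtain ⟨M, hM⟩ : ∃ M, ∀ p ∈ F.cell, ‖B p‖ ≤ M := by
    refine F.isCompact_cell.exists_bound_of_continuousOn (ContinuousOn.div ?_ ?_
      fun p hp => hstag p hp.1)
    · exact (continuous_const.mul (hWYd.continuous.add
        (F.continuous_vort.mul F.u_smooth.continuous))).continuousOn
    · exact ((F.u_smooth.continuous.pow 2).add (F.v_smooth.continuous.pow 2)).continuousOn
  set α := |M| + 1 with hα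
  have hαpos : 0 < α := by positivity
  have hBα : ∀ p ∈ F.cell, 0 < B p + α := fun p hp => by
    have h1 := (abs_le.1 (hM p hp)).1
    have h2 := le_abs_self M
    linarith
  have hε : ∀ ε > 0, W q + ε * Real.exp (α * q.2)
      ≤ Patm + g * F.maxη + ε * Real.exp (α * F.maxη) := by
    intro ε hε
    set V : ℝ × ℝ → ℝ := fun p => W p + ε * Real.exp (α * p.2) with hV
    have hVc : ContDiff ℝ 2 V :=
      hWc.add (contDiff_const.mul (Real.contDiff_exp.comp (contDiff_const.mul contDiff_snd)))
    have hVd : Differentiable ℝ V := hVc.differentiable two_ne_zero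
    have hexp : ∀ y : ℝ, HasDerivAt (fun t => Real.exp (α * t)) (α * Real.exp (α * y)) y := by
      intro y
      refine (((hasDerivAt_id y).const_mul α).exp).congr_deriv ?_
      simp [mul_comm]
    have hVX : pdX V = pdX W := by
      ext ⟨x, y⟩
      exact pdX_eq_of_hasDerivAt (hVd _) ((hasDerivAt_slice_x (hWd (x, y))).add_const
        (ε * Real.exp (α * y)))
    have hVY : pdY V = fun p => pdY W p + ε * (α * Real.exp (α * p.2)) := by
      ext ⟨x, y⟩
      exact pdY_eq_of_hasDerivAt (hVd _)
        ((hasDerivAt_slice_y (hWd (x, y))).fun_add ((hexp y).const_mul ε))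
    have hVYd : Differentiable ℝ (pdY V) :=
      (contDiff_pdY hVc (m := 1) (by norm_num)).differentiable one_ne_zero
    have hVYY : ∀ p, pdY (pdY V) p
        = pdY (pdY W) p + ε * (α * (α * Real.exp (α * p.2))) := by
      rintro ⟨x, y⟩
      refine pdY_eq_of_hasDerivAt (hVYd _) ?_
      rw [hVY]
      exact (hasDerivAt_slice_y (hWYd (x, y))).fun_add (((hexp y).const_mul α).const_mul ε)
    refine F.le_of_surface_le hL hVd (fun p _ => ?_) (fun p hp hpΩ hmax => ?_) (fun x => ?_)
      (fun s => ?_) hq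
    · simp only [hV, hW, F.P_periodic]
    · obtain ⟨c1, c2, c3, c4⟩ := hmax.pd_conditions hVc
      rw [hVX] at c1 c3
      rw [hVYY] at c4
      rw [hVY] at c2
      simp only at c2
      set σ := ε * (α * Real.exp (α * p.2)) with hσ
      have hσpos : 0 < σ := by positivity
      have hlap := laplacian_of_advection F.Ω_open F.u_smooth F.v_smooth hWc
        (fun p hp => by rw [hWX, F.euler_x p hp])
        (fun p hp => by rw [hWY, F.euler_y p hp]; ring) F.incompressible hpΩ
      have hdiv := F.incompressible p hpΩ
      have hx := F.euler_x p hpΩ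
      have hy := F.euler_y p hpΩ
      rw [← hWX, c1] at hx
      have hy' : F.u p * pdX F.v p + F.v p * pdY F.v p = σ := by
        rw [hy]
        linarith [hWY p]
      have hq2 := hstag p hp.1
      have hlap' : pdX (pdX W) p + pdY (pdY W) p = B p * σ := by
        rw [hlap, hB]
        simp only [vort]
        rw [show pdY W p = -σ by linarith, ← hy', show pdY F.v p = -pdX F.u p by linarith]
        field_simp
        linear_combination (-2 * (F.u p * pdX F.u p + F.v p * pdX F.v p)) * hx
      have hpos := mul_pos (hBα p hp) hσpos
      have : ε * (α * (α * Real.exp (α * p.2))) = α * σ := by rw [hσ]; ring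
      rw [this] at c4
      linarith
    · have hbm := F.bed_mem_closure x
      have h1 := F.euler_y_closure hbm
      have h2 : pdX F.v (x, -d) = 0 := by
        refine pdX_eq_of_hasDerivAt (F.differentiable_v _) ?_
        simp only [F.bed_kinematic]
        exact hasDerivAt_const _ _
      rw [F.bed_kinematic, h2, mul_zero, zero_mul, add_zero] at h1
      rw [hVY]
      simp only
      rw [show pdY W (x, -d) = 0 by linarith [hWY (x, -d)], zero_add]
      positivity
    · have h1 := F.Y_le_maxη s
      simp only [hV, hW, F.surface_pressure]
      gcongr
  have hlim : Tendsto (fun ε : ℝ => Patm + g * F.maxη + ε * Real.exp (α * F.maxη)) (𝓝[>] 0)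
      (𝓝 (Patm + g * F.maxη)) := by
    have : Continuous fun ε : ℝ => Patm + g * F.maxη + ε * Real.exp (α * F.maxη) := by fun_prop
    simpa using (this.tendsto 0).mono_left nhdsWithin_le_nhds
  refine ge_of_tendsto hlim ?_
  filter_upwards [self_mem_nhdsWithin] with ε (h : 0 < ε)
  have := hε ε h
  have h2 : 0 ≤ ε * Real.exp (α * q.2) := by positivity
  simp only [hW] at this
  linarith

end GenPeriodicFlow

/-- **Speed minimized at crests for nonpositive vorticity.**  For a nontrivial flow with
no stagnation points in the closure of `Ω`, if `ω ≤ 0` throughout `Ω` and `u < 0` at some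
crest or at some trough, then the relative speed `√(u² + v²)` is minimized at every
crest. -/
theorem speed_minimized_at_crests (g Patm L d : ℝ) (hg : 0 < g) (hL : 0 < L) (hd : 0 < d)
    (F : GenPeriodicFlow g Patm L d)
    (hnt : F.Nontrivial')
    (hstag : ∀ p ∈ closure F.Ω, F.u p ^ 2 + F.v p ^ 2 ≠ 0)
    (hω : ∀ p ∈ F.Ω, F.vort p ≤ 0)
    (hu : ∃ s, (F.Y s = F.maxη ∨ F.Y s = F.minη) ∧ F.u (F.X s, F.Y s) < 0) :
    ∀ s', F.Y s' = F.maxη → ∀ p ∈ closure F.Ω,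
      F.u (F.X s', F.Y s') ^ 2 + F.v (F.X s', F.Y s') ^ 2 ≤ F.u p ^ 2 + F.v p ^ 2 := by
  intro s' hs' p hp
  obtain ⟨s, hs, hus⟩ := hu
  have hpos : ∃ q ∈ closure F.Ω, 0 < F.ψ q := by
    rcases hs with hs | hs
    · exact F.exists_ψ_pos_of_crest hL hs hus
    · exact F.exists_ψ_pos_of_trough hs hus
  have h1 := F.head_surface_le hL hstag hω (F.u_bed_neg hL hstag hpos) s' hp
  have h2 := F.pressure_add_le hL hg hstag hp
  have h3 := F.surface_pressure s'
  rw [hs'] at h3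
  simp only [GenPeriodicFlow.head, hs', h3] at h1
  rw [hs']
  linarith
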